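/- Fix N ≥ 1 and a diagonal matrix D = diag(d_1,…,d_N) such that d_i − d_j is a positive integer whenever i < j. Let β be a strictly upper triangular complex N×N matrix with graded components β_n, and let v be holomorphic in a neighborhood of 0 ∈ ℂ with v(0) = 1. For z ≠ 0 define γ_v(z) = Te^{−(1/z)∫_0^{v(z)} u^Y(β) du/u}, the time-ordered exponential along the straight path u = t·v(z), t ∈ [0,1], of the 1-form −(1/z)·Σ_{n≥1} u^{n−1} β_n du. Then the Birkhoff decomposition of γ_v is given by γ_v(z) = γ_v^−(z)^{−1}·γ_v^+(z), where γ_v^−(z)^{−1} = Te^{−(1/z)∫_0^1 u^Y(β) du/u} (straight path from 0 to 1), whose off-diagonal entries are polynomials in z^{−1} without constant term, and γ_v^+(z) = Te^{−(1/z)∫_1^{v(z)} u^Y(β) du/u} (straight path from 1 to v(z)), whose entries extend holomorphically across z = 0. -/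

import Mathlib

open MeasureTheory Filter Topology
noncomputable section
attribute [local instance] Matrix.normedAddCommGroup Matrix.normedSpace

/-- The graded component `x_n` of a matrix `x`, supported on the positions
`(i,j)` with `d i − d j = n`, for `D = diag d`. -/
def gpart {N : ℕ} (d : Fin N → ℂ) (n : ℕ) (x : Matrix (Fin N) (Fin N) ℂ) :
    Matrix (Fin N) (Fin N) ℂ :=
  Matrix.of fun i j => if d i - d j = (n : ℂ) then x i j else 0

/-- `u^Y(x)/u = Σ_{n≥1} u^{n−1} x_n`, which is entire in `u`. -/
def uYdiv {N : ℕ} (d : Fin N → ℂ) (u : ℂ) (x : Matrix (Fin N) (Fin N) ℂ) :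
    Matrix (Fin N) (Fin N) ℂ :=
  ∑' n : ℕ, u ^ n • gpart d (n + 1) x

/-- A strictly upper triangular matrix. -/
def SUT {N : ℕ} (x : Matrix (Fin N) (Fin N) ℂ) : Prop :=
  ∀ i j : Fin N, ¬ i < j → x i j = 0

/-- The ordered simplex `{a ≤ s 0 ≤ s 1 ≤ ⋯ ≤ s (n-1) ≤ b}`. -/
def orderedSimplex (n : ℕ) (a b : ℝ) : Set (Fin n → ℝ) :=
  {s | (∀ i, s i ∈ Set.Icc a b) ∧ Monotone s}

/-- A germ belonging to the subring `O ⊂ K` of germs holomorphic at `0`. -/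
def MemO (f : ℂ → ℂ) : Prop :=
  ∃ g : ℂ → ℂ, AnalyticAt ℂ g 0 ∧ f =ᶠ[𝓝[≠] (0 : ℂ)] g

/-- A germ belonging to `Q = z⁻¹ ℂ[z⁻¹]`: polynomials in `z⁻¹` without
constant term. -/
def MemQ (f : ℂ → ℂ) : Prop :=
  ∃ p : Polynomial ℂ, p.coeff 0 = 0 ∧
    ∀ᶠ z in 𝓝[≠] (0 : ℂ), f z = Polynomial.eval z⁻¹ p

/-- `Te^{−(1/z)∫_{c₀}^{c₁} u^Y(β) du/u}`: the time-ordered exponential of the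
1-form `−(1/z)·Σ_{n≥1} u^{n−1} β_n du` along the straight path from `c₀` to
`c₁` (pullback `t ↦ −(1/z)(c₁−c₀)·Σ_{n≥1} (c₀+t(c₁−c₀))^{n−1} β_n`). -/
def TexpPath {N : ℕ} (d : Fin N → ℂ) (β : Matrix (Fin N) (Fin N) ℂ)
    (z c₀ c₁ : ℂ) : Matrix (Fin N) (Fin N) ℂ :=
  ∑' n : ℕ, ∫ s in orderedSimplex n 0 1,
    (List.ofFn fun i : Fin n =>
      (-z⁻¹ * (c₁ - c₀)) • uYdiv d (c₀ + (s i : ℂ) * (c₁ - c₀)) β).prod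

lemma isCompact_orderedSimplex (n : ℕ) (a b : ℝ) : IsCompact (orderedSimplex n a b) := by
  have h : IsCompact (Set.univ.pi fun _ : Fin n => Set.Icc a b) :=
    isCompact_univ_pi fun _ => isCompact_Icc
  have hs : orderedSimplex n a b =
      (Set.univ.pi fun _ : Fin n => Set.Icc a b) ∩ {s | Monotone s} := by
    ext s
    simp only [orderedSimplex, Set.mem_ofPred_eq, Set.mem_inter_iff, Set.mem_univ_pi]
  rw [hs]
  exact h.inter_right isClosed_monotone

lemma snoc_mem_orderedSimplex_iff {n : ℕ} {a b x : ℝ} {y : Fin n → ℝ} :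
    (Fin.snoc y x : Fin (n + 1) → ℝ) ∈ orderedSimplex (n + 1) a b ↔
      x ∈ Set.Icc a b ∧ y ∈ orderedSimplex n a x := by
  constructor
  · rintro ⟨h, hm⟩
    have hx : x ∈ Set.Icc a b := by simpa using h (Fin.last n)
    refine ⟨hx, fun i => ⟨by simpa using (h i.castSucc).1, ?_⟩, fun i j hij => ?_⟩
    · simpa using hm (Fin.le_last i.castSucc)
    · simpa using hm (Fin.castSucc_le_castSucc_iff.2 hij)
  · rintro ⟨hx, h, hm⟩
    refine ⟨fun i => ?_, fun i j hij => ?_⟩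
    · refine Fin.lastCases (by simpa using hx) (fun i => ?_) i
      simpa using ⟨(h i).1, (h i).2.trans hx.2⟩
    · induction j using Fin.lastCases with
      | last =>
        induction i using Fin.lastCases with
        | last => exact le_rfl
        | cast i => simpa using (h i).2
      | cast j =>
        induction i using Fin.lastCases with
        | last => exact absurd hij (not_le.2 (Fin.castSucc_lt_last j))
        | cast i => simpa using hm (Fin.castSucc_le_castSucc_iff.1 hij)

/-- The last variable of an integral over the ordered simplex can be integrated last. -/
lemma setIntegral_orderedSimplex_succ {E : Type*} [NormedAddCommGroup E] [NormedSpace ℝ E]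
    {n : ℕ} {f : (Fin (n + 1) → ℝ) → E} (hf : Continuous f) (a b : ℝ) :
    ∫ s in orderedSimplex (n + 1) a b, f s =
      ∫ x in Set.Icc a b, ∫ y in orderedSimplex n a x, f (Fin.snoc y x) := by
  have hmeas (m : ℕ) (c : ℝ) : MeasurableSet (orderedSimplex m a c) :=
    (isCompact_orderedSimplex m a c).isClosed.measurableSet
  have hint : Integrable ((orderedSimplex (n + 1) a b).indicator f) :=
    (integrable_indicator_iff (hmeas _ _)).2
      (hf.continuousOn.integrableOn_compact (isCompact_orderedSimplex _ a b))
  have hmp := (volume_preserving_piFinSuccAbove (fun _ : Fin (n + 1) => ℝ) (Fin.last n)).symm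
  have hint' := (hmp.integrable_comp_emb (MeasurableEquiv.measurableEmbedding _)).2 hint
  rw [← integral_indicator (hmeas _ _), ← hmp.integral_comp', Measure.volume_eq_prod]
  refine (integral_prod _ hint').trans ?_
  rw [← integral_indicator measurableSet_Icc]
  congr 1
  funext x
  have hsnoc (y : Fin n → ℝ) :
      (MeasurableEquiv.piFinSuccAbove (fun _ : Fin (n + 1) => ℝ) (Fin.last n)).symm (x, y) =
        (Fin.snoc y x : Fin (n + 1) → ℝ) :=
    Fin.insertNth_last' x y
  by_cases hx : x ∈ Set.Icc a b
  · rw [Set.indicator_of_mem hx, ← integral_indicator (hmeas _ _)]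
    congr 1
    funext y
    rw [Function.comp_apply, hsnoc]
    by_cases hy : y ∈ orderedSimplex n a x
    · rw [Set.indicator_of_mem hy,
        Set.indicator_of_mem (snoc_mem_orderedSimplex_iff.2 ⟨hx, hy⟩)]
    · rw [Set.indicator_of_notMem hy,
        Set.indicator_of_notMem fun h => hy (snoc_mem_orderedSimplex_iff.1 h).2]
  · rw [Set.indicator_of_notMem hx, ← integral_zero (Fin n → ℝ) E]
    congr 1
    funext y
    rw [Function.comp_apply, hsnoc,
      Set.indicator_of_notMem fun h => hx (snoc_mem_orderedSimplex_iff.1 h).1]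

lemma IsCompact.setIntegral_linearMap_comp {X E F : Type*} [TopologicalSpace X]
    [MeasurableSpace X] [OpensMeasurableSpace X] [T2Space X] {μ : Measure X}
    [IsFiniteMeasureOnCompacts μ]
    [NormedAddCommGroup E] [NormedSpace ℝ E] [FiniteDimensional ℝ E]
    [NormedAddCommGroup F] [NormedSpace ℝ F] [CompleteSpace F]
    {K : Set X} (hK : IsCompact K) {f : X → E} (hf : Continuous f) (L : E →ₗ[ℝ] F) :
    ∫ x in K, L (f x) ∂μ = L (∫ x in K, f x ∂μ) :=
  have := FiniteDimensional.complete ℝ E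
  L.toContinuousLinearMap.integral_comp_comm (hf.continuousOn.integrableOn_compact hK)

lemma setIntegral_Icc_eq_sub_of_hasDerivAt {E : Type*} [NormedAddCommGroup E] [NormedSpace ℝ E]
    [CompleteSpace E] {g g' : ℝ → E} (hg : ∀ x, HasDerivAt g (g' x) x) (hg' : Continuous g')
    {a b : ℝ} (hab : a ≤ b) : ∫ x in Set.Icc a b, g' x = g b - g a := by
  rw [integral_Icc_eq_integral_Ioc, ← intervalIntegral.integral_of_le hab,
    intervalIntegral.integral_eq_sub_of_hasDerivAt (fun x _ => hg x) (hg'.intervalIntegrable _ _)]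

/-- Iterated integrals of a continuous matrix-valued function over ordered simplices are given by
any sequence of successive primitives. -/
lemma setIntegral_orderedSimplex_prod_ofFn {ι : Type*} [Fintype ι] [DecidableEq ι]
    {α : ℝ → Matrix ι ι ℂ} (hα : Continuous α) {A : ℕ → ℝ → Matrix ι ι ℂ} {a : ℝ}
    (hA0 : ∀ t, A 0 t = 1) (hAa : ∀ n, A (n + 1) a = 0)
    (hA : ∀ n t, HasDerivAt (A (n + 1)) (A n t * α t) t) (n : ℕ) {t : ℝ} (ht : a ≤ t) :
    ∫ s in orderedSimplex n a t, (List.ofFn fun i : Fin n => α (s i)).prod = A n t := by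
  have hcont (m : ℕ) : Continuous fun s : Fin m → ℝ => (List.ofFn fun i => α (s i)).prod := by
    induction m with
    | zero => simpa using continuous_const
    | succ m ih =>
      simp only [List.ofFn_succ, List.prod_cons]
      exact (hα.comp (continuous_apply 0)).matrix_mul
        (ih.comp (continuous_pi fun i : Fin m => continuous_apply i.succ))
  have hAcont (m : ℕ) : Continuous (A m) := by
    cases m with
    | zero => exact (continuous_const (y := (1 : Matrix ι ι ℂ))).congr fun t => (hA0 t).symm
    | succ m => exact continuous_iff_continuousAt.2 fun t => (hA m t).continuousAt
  induction n generalizing t with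
  | zero =>
    have h : orderedSimplex 0 a t = Set.univ :=
      Set.eq_univ_of_forall fun s => ⟨fun i => i.elim0, fun i => i.elim0⟩
    simp [h, hA0, Measure.real, volume_pi]
  | succ n ih =>
    rw [setIntegral_orderedSimplex_succ (hcont (n + 1))]
    have hstep : ∀ x ∈ Set.Icc a t, ∫ y in orderedSimplex n a x,
        (List.ofFn fun i : Fin (n + 1) => α ((Fin.snoc y x : Fin (n + 1) → ℝ) i)).prod =
          A n x * α x := by
      intro x hx
      rw [← ih hx.1]
      rw [← LinearMap.mulRight_apply (R := ℝ),
        ← (isCompact_orderedSimplex n a x).setIntegral_linearMap_comp (hcont n)]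
      simp only [List.ofFn_succ', List.concat_eq_append, List.prod_append, List.prod_singleton,
        Fin.snoc_castSucc, Fin.snoc_last, LinearMap.mulRight_apply]
    rw [setIntegral_congr_fun measurableSet_Icc hstep, setIntegral_Icc_eq_sub_of_hasDerivAt (hA n)
      ((hAcont n).matrix_mul hα) ht, hAa, sub_zero]

lemma Polynomial.exists_primitive (c : ℂ) (p : Polynomial ℂ) :
    ∃ q : Polynomial ℂ, Polynomial.derivative q = p ∧ q.eval c = 0 := by
  obtain ⟨q, hq⟩ : ∃ q : Polynomial ℂ, Polynomial.derivative q = p := by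
    induction p using Polynomial.induction_on' with
    | add p₁ p₂ h₁ h₂ =>
      obtain ⟨q₁, rfl⟩ := h₁
      obtain ⟨q₂, rfl⟩ := h₂
      exact ⟨q₁ + q₂, Polynomial.derivative_add⟩
    | monomial n a =>
      refine ⟨Polynomial.monomial (n + 1) (a / (n + 1)), ?_⟩
      rw [Polynomial.derivative_monomial, Nat.add_sub_cancel]
      congr 1
      push_cast
      exact div_mul_cancel₀ a (Nat.cast_add_one_ne_zero n)
  exact ⟨q - Polynomial.C (q.eval c), by simp [hq], by simp⟩

/-- The primitive of a complex polynomial vanishing at `c`. -/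
def Polynomial.primitive (c : ℂ) (p : Polynomial ℂ) : Polynomial ℂ :=
  (Polynomial.exists_primitive c p).choose

lemma Polynomial.derivative_primitive (c : ℂ) (p : Polynomial ℂ) :
    Polynomial.derivative (Polynomial.primitive c p) = p :=
  (Polynomial.exists_primitive c p).choose_spec.1

lemma Polynomial.eval_primitive_self (c : ℂ) (p : Polynomial ℂ) :
    (Polynomial.primitive c p).eval c = 0 :=
  (Polynomial.exists_primitive c p).choose_spec.2

lemma Polynomial.eq_zero_of_derivative_eq_zero_of_eval {c : ℂ} {p : Polynomial ℂ}
    (h : Polynomial.derivative p = 0) (hc : p.eval c = 0) : p = 0 := by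
  rw [Polynomial.eq_C_of_derivative_eq_zero h] at hc ⊢
  simpa using hc

lemma Polynomial.primitive_zero (c : ℂ) : Polynomial.primitive c 0 = 0 :=
  Polynomial.eq_zero_of_derivative_eq_zero_of_eval (Polynomial.derivative_primitive c 0)
    (Polynomial.eval_primitive_self c 0)

lemma Polynomial.pow_succ_dvd_primitive {c : ℂ} {n : ℕ} {p : Polynomial ℂ}
    (h : (Polynomial.X - Polynomial.C c) ^ n ∣ p) :
    (Polynomial.X - Polynomial.C c) ^ (n + 1) ∣ Polynomial.primitive c p := by
  rcases eq_or_ne p 0 with rfl | hp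
  · simp [Polynomial.primitive_zero]
  have hq : Polynomial.primitive c p ≠ 0 := fun h0 => hp <| by
    rw [← Polynomial.derivative_primitive c p, h0, Polynomial.derivative_zero]
  have hroot : (Polynomial.primitive c p).IsRoot c := Polynomial.eval_primitive_self c p
  rw [← Polynomial.le_rootMultiplicity_iff hq]
  have h1 := Polynomial.derivative_rootMultiplicity_of_root hroot
  rw [Polynomial.derivative_primitive] at h1
  have h2 := (Polynomial.le_rootMultiplicity_iff hp).2 h
  have h3 := (Polynomial.rootMultiplicity_pos hq).2 hroot
  omega

/-- The successive primitives `F₀ = 1`, `F_{n+1}' = F_n M`, `F_{n+1}(c) = 0` of a polynomial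
matrix `M`. -/
def iteratedPrimitive {N : ℕ} (M : Matrix (Fin N) (Fin N) (Polynomial ℂ)) (c : ℂ) :
    ℕ → Matrix (Fin N) (Fin N) (Polynomial ℂ)
  | 0 => 1
  | n + 1 => (iteratedPrimitive M c n * M).map (Polynomial.primitive c)

section

variable {N : ℕ} {M : Matrix (Fin N) (Fin N) (Polynomial ℂ)}

lemma iteratedPrimitive_apply_eq_zero (hM : ∀ i j, ¬ i < j → M i j = 0) (c : ℂ) (n : ℕ)
    {i j : Fin N} (hij : (j : ℕ) < i + n) : iteratedPrimitive M c n i j = 0 := by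
  induction n generalizing j with
  | zero => exact Matrix.one_apply_ne fun h => by simp [h] at hij
  | succ n ih =>
    have h : (iteratedPrimitive M c n * M) i j = 0 := by
      rw [Matrix.mul_apply]
      refine Finset.sum_eq_zero fun k _ => ?_
      by_cases hk : k < j
      · rw [ih (by have : (k : ℕ) < j := hk; omega), zero_mul]
      · rw [hM k j hk, mul_zero]
    simp [iteratedPrimitive, h, Polynomial.primitive_zero]

lemma iteratedPrimitive_eq_zero (hM : ∀ i j, ¬ i < j → M i j = 0) (c : ℂ) {n : ℕ} (hn : N ≤ n) :
    iteratedPrimitive M c n = 0 := by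
  ext1 i j
  exact iteratedPrimitive_apply_eq_zero hM c n (by omega)

lemma iteratedPrimitive_apply_self (hM : ∀ i j, ¬ i < j → M i j = 0) (c : ℂ) (n : ℕ) (i : Fin N) :
    iteratedPrimitive M c n i i = if n = 0 then 1 else 0 := by
  cases n with
  | zero => simp [iteratedPrimitive]
  | succ n => simpa using iteratedPrimitive_apply_eq_zero hM c (n + 1) (i := i) (by omega)

lemma pow_dvd_iteratedPrimitive (c : ℂ) (n : ℕ) (i j : Fin N) :
    (Polynomial.X - Polynomial.C c) ^ n ∣ iteratedPrimitive M c n i j := by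
  induction n generalizing j with
  | zero => simp
  | succ n ih =>
    refine Polynomial.pow_succ_dvd_primitive ?_
    rw [Matrix.mul_apply]
    exact Finset.dvd_sum fun k _ => Dvd.dvd.mul_right (ih k) _

/-- The generating function `∑ n, xⁿ Fₙ` of the successive primitives of a nilpotent `M`. -/
def iteratedPrimitiveSum (M : Matrix (Fin N) (Fin N) (Polynomial ℂ)) (x c : ℂ) :
    Matrix (Fin N) (Fin N) (Polynomial ℂ) :=
  ∑ n ∈ Finset.range N, x ^ n • iteratedPrimitive M c n

lemma map_derivative_iteratedPrimitiveSum (hM : ∀ i j, ¬ i < j → M i j = 0) (x c : ℂ) :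
    (iteratedPrimitiveSum M x c).map Polynomial.derivative =
      x • (iteratedPrimitiveSum M x c * M) := by
  have h1 : iteratedPrimitiveSum M x c =
      ∑ n ∈ Finset.range (N + 1), x ^ n • iteratedPrimitive M c n := by
    rw [Finset.sum_range_succ, iteratedPrimitive_eq_zero hM c le_rfl, smul_zero, add_zero]
    rfl
  have h2 : iteratedPrimitiveSum M x c =
      1 + ∑ n ∈ Finset.range N, x ^ (n + 1) • iteratedPrimitive M c (n + 1) := by
    rw [h1, Finset.sum_range_succ', add_comm]
    simp [iteratedPrimitive]
  ext1 i j
  conv_lhs => rw [h2]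
  have h3 : Polynomial.derivative ((1 : Matrix (Fin N) (Fin N) (Polynomial ℂ)) i j) = 0 := by
    rw [Matrix.one_apply]
    split_ifs <;> simp
  simp only [Matrix.map_apply, Matrix.add_apply, Matrix.sum_apply, Matrix.smul_apply, map_add,
    map_sum, h3, zero_add, Polynomial.derivative_smul, iteratedPrimitive,
    Polynomial.derivative_primitive, iteratedPrimitiveSum, Finset.sum_mul, Finset.smul_sum,
    smul_mul_assoc, smul_smul, pow_succ']

lemma map_eval_iteratedPrimitiveSum_self (hN : 1 ≤ N) (x c : ℂ) :
    (iteratedPrimitiveSum M x c).map (Polynomial.eval c) = 1 := by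
  obtain ⟨K, rfl⟩ := Nat.exists_eq_add_of_le' hN
  ext i j
  simp [iteratedPrimitiveSum, Finset.sum_range_succ', Matrix.sum_apply, iteratedPrimitive,
    Polynomial.eval_finsetSum, Polynomial.eval_primitive_self, Matrix.one_apply, apply_ite]

/-- A polynomial solution of `H' = x H M` with `M` nilpotent vanishes as soon as it vanishes at
one point. -/
lemma eq_zero_of_map_derivative_eq (hM : ∀ i j, ¬ i < j → M i j = 0) {x c : ℂ}
    {H : Matrix (Fin N) (Fin N) (Polynomial ℂ)}
    (hH : H.map Polynomial.derivative = x • (H * M)) (hc : H.map (Polynomial.eval c) = 0) :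
    H = 0 := by
  ext1 i j
  induction j using WellFoundedLT.induction with
  | ind j ih =>
    refine Polynomial.eq_zero_of_derivative_eq_zero_of_eval (c := c) ?_ (congrFun₂ hc i j)
    have h : (H * M) i j = 0 := by
      rw [Matrix.mul_apply]
      refine Finset.sum_eq_zero fun k _ => ?_
      by_cases hk : k < j
      · rw [ih k hk, Matrix.zero_apply, zero_mul]
      · rw [hM k j hk, mul_zero]
    simpa [h] using congrFun₂ hH i j

lemma iteratedPrimitiveSum_eq_mul (hN : 1 ≤ N) (hM : ∀ i j, ¬ i < j → M i j = 0) (x a b : ℂ) :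
    iteratedPrimitiveSum M x a =
      ((iteratedPrimitiveSum M x a).map (Polynomial.eval b)).map Polynomial.C *
        iteratedPrimitiveSum M x b := by
  set P := ((iteratedPrimitiveSum M x a).map (Polynomial.eval b))
  have hd : (P.map Polynomial.C * iteratedPrimitiveSum M x b).map Polynomial.derivative =
      P.map Polynomial.C * (iteratedPrimitiveSum M x b).map Polynomial.derivative := by
    ext1 i j
    simp [Matrix.mul_apply, Polynomial.derivative_mul]
  have he : (P.map Polynomial.C * iteratedPrimitiveSum M x b).map (Polynomial.eval b) =
      P * (iteratedPrimitiveSum M x b).map (Polynomial.eval b) := by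
    ext1 i j
    simp [Matrix.mul_apply, Polynomial.eval_finsetSum]
  refine sub_eq_zero.1 (eq_zero_of_map_derivative_eq hM (x := x) (c := b) ?_ ?_)
  · rw [Matrix.map_sub _ (fun p q => Polynomial.derivative_sub), hd,
      map_derivative_iteratedPrimitiveSum hM, map_derivative_iteratedPrimitiveSum hM,
      Matrix.mul_smul, sub_mul, smul_sub, mul_assoc]
  · rw [Matrix.map_sub _ (fun p q => Polynomial.eval_sub p q b), he,
      map_eval_iteratedPrimitiveSum_self hN, mul_one, sub_self]

end

lemma exists_polynomial_uYdiv {N : ℕ} {d : Fin N → ℂ}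
    (hd : ∀ i j : Fin N, i < j → ∃ n : ℕ, 0 < n ∧ d i - d j = (n : ℂ))
    {β : Matrix (Fin N) (Fin N) ℂ} (hβ : SUT β) :
    ∃ M : Matrix (Fin N) (Fin N) (Polynomial ℂ), (∀ i j, ¬ i < j → M i j = 0) ∧
      ∀ u, uYdiv d u β = M.map (Polynomial.eval u) := by
  have he (i j : Fin N) : ∃ n : ℕ, i < j → d i - d j = ((n + 1 : ℕ) : ℂ) := by
    by_cases hij : i < j
    · obtain ⟨n, hn, h⟩ := hd i j hij
      exact ⟨n - 1, fun _ => by rw [h, Nat.sub_add_cancel hn]⟩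
    · exact ⟨0, fun h => absurd h hij⟩
  choose e he using he
  refine ⟨Matrix.of fun i j => Polynomial.C (β i j) * Polynomial.X ^ e i j,
    fun i j hij => by simp [hβ i j hij], fun u => HasSum.tsum_eq ?_⟩
  refine Pi.hasSum.2 fun i => Pi.hasSum.2 fun j => ?_
  by_cases hij : i < j
  · have hg (n : ℕ) : (u ^ n • gpart d (n + 1) β) i j = if n = e i j then
        β i j * u ^ e i j else 0 := by
      simp only [gpart, Matrix.smul_apply, Matrix.of_apply, he i j hij, Nat.cast_inj,
        add_left_inj, smul_eq_mul]
      rcases eq_or_ne n (e i j) with rfl | hn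
      · simp [mul_comm]
      · simp [hn, hn.symm]
    simp only [hg, Matrix.map_apply, Matrix.of_apply, Polynomial.eval_mul, Polynomial.eval_C,
      Polynomial.eval_pow, Polynomial.eval_X]
    exact hasSum_ite_eq (e i j) _
  · simp [gpart, hβ i j hij, hasSum_zero]

/-- The time-ordered exponential is the value at `c₁` of the sum of successive primitives. -/
lemma TexpPath_eq_map_eval {N : ℕ} {d : Fin N → ℂ} {β : Matrix (Fin N) (Fin N) ℂ}
    {M : Matrix (Fin N) (Fin N) (Polynomial ℂ)} (hM : ∀ i j, ¬ i < j → M i j = 0)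
    (hMβ : ∀ u, uYdiv d u β = M.map (Polynomial.eval u)) (z c₀ c₁ : ℂ) :
    TexpPath d β z c₀ c₁ =
      (iteratedPrimitiveSum M (-z⁻¹) c₀).map (Polynomial.eval c₁) := by
  have hline (t : ℝ) : HasDerivAt (fun t : ℝ => c₀ + (t : ℂ) * (c₁ - c₀)) (c₁ - c₀) t := by
    simpa using ((Complex.ofRealCLM.hasDerivAt (x := t)).mul_const (c₁ - c₀)).const_add c₀
  have hcline : Continuous fun t : ℝ => c₀ + (t : ℂ) * (c₁ - c₀) := by fun_prop
  have hα : Continuous fun t : ℝ =>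
      (-z⁻¹ * (c₁ - c₀)) • uYdiv d (c₀ + (t : ℂ) * (c₁ - c₀)) β := by
    have h : Continuous fun t : ℝ => M.map (Polynomial.eval (c₀ + (t : ℂ) * (c₁ - c₀))) :=
      continuous_matrix fun i j => (M i j).continuous.comp hcline
    simp only [hMβ]
    exact h.const_smul (-z⁻¹ * (c₁ - c₀))
  have hint (n : ℕ) := setIntegral_orderedSimplex_prod_ofFn hα (a := 0) (t := 1)
    (A := fun n t => (-z⁻¹) ^ n •
      (iteratedPrimitive M c₀ n).map (Polynomial.eval (c₀ + (t : ℂ) * (c₁ - c₀))))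
    (fun t => by simp [iteratedPrimitive])
    (fun n => by
      ext i j
      simp [iteratedPrimitive, Polynomial.eval_primitive_self])
    (fun n t => by
      refine hasDerivAt_pi.2 fun i => hasDerivAt_pi.2 fun j => ?_
      have h1 := ((iteratedPrimitive M c₀ (n + 1) i j).hasDerivAt
        (c₀ + (t : ℂ) * (c₁ - c₀))).comp t (hline t)
      refine (h1.const_mul ((-z⁻¹) ^ (n + 1))).congr_deriv ?_
      simp only [iteratedPrimitive, Matrix.map_apply, Polynomial.derivative_primitive, hMβ,
        Matrix.mul_apply, Matrix.smul_apply, Polynomial.eval_finsetSum, Polynomial.eval_mul,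
        smul_eq_mul, Finset.mul_sum, Finset.sum_mul]
      exact Finset.sum_congr rfl fun k _ => by ring) n zero_le_one
  unfold TexpPath
  simp only [hint]
  rw [tsum_eq_sum (s := Finset.range N)]
  · ext i j
    simp [iteratedPrimitiveSum, Matrix.sum_apply, Polynomial.eval_finsetSum]
  · intro n hn
    rw [iteratedPrimitive_eq_zero hM c₀ (by simpa using hn)]
    ext i j
    simp

/-- Birkhoff decomposition of `γ_v(z) = Te^{−(1/z)∫_0^{v(z)} u^Y(β) du/u}`:
`γ_v = (γ_v^−)⁻¹·γ_v^+` with `γ_v^−(z)⁻¹ = Te^{−(1/z)∫_0^1 u^Y(β) du/u}`,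
whose off-diagonal entries are polynomials in `z⁻¹` without constant term,
and `γ_v^+(z) = Te^{−(1/z)∫_1^{v(z)} u^Y(β) du/u}`, whose entries extend
holomorphically across `z = 0`. -/
theorem stmt11 {N : ℕ} (hN : 1 ≤ N) (d : Fin N → ℂ)
    (hd : ∀ i j : Fin N, i < j → ∃ n : ℕ, 0 < n ∧ d i - d j = (n : ℂ))
    (β : Matrix (Fin N) (Fin N) ℂ) (hβ : SUT β)
    (v : ℂ → ℂ) (hv : AnalyticAt ℂ v 0) (hv0 : v 0 = 1) :
    (∀ z : ℂ, z ≠ 0 →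
      TexpPath d β z 0 (v z) = TexpPath d β z 0 1 * TexpPath d β z 1 (v z)) ∧
    ((∀ z : ℂ, z ≠ 0 →
        (∀ i j : Fin N, j < i → TexpPath d β z 0 1 i j = 0) ∧
        (∀ i : Fin N, TexpPath d β z 0 1 i i = 1)) ∧
      (∀ i j : Fin N, i ≠ j → MemQ (fun z => TexpPath d β z 0 1 i j))) ∧
    (∀ i j : Fin N, MemO (fun z => TexpPath d β z 1 (v z) i j)) := by
  obtain ⟨M, hM, hMβ⟩ := exists_polynomial_uYdiv hd hβ
  have happly (z c₀ c₁ : ℂ) (i j : Fin N) : TexpPath d β z c₀ c₁ i j =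
      ∑ n ∈ Finset.range N, (-z⁻¹) ^ n * (iteratedPrimitive M c₀ n i j).eval c₁ := by
    simp [TexpPath_eq_map_eval hM hMβ, iteratedPrimitiveSum, Matrix.sum_apply,
      Polynomial.eval_finsetSum]
  refine ⟨fun z _ => ?_, ⟨fun z _ => ⟨fun i j hij => ?_, fun i => ?_⟩, fun i j hij => ?_⟩,
    fun i j => ?_⟩
  · simp only [TexpPath_eq_map_eval hM hMβ]
    conv_lhs => rw [iteratedPrimitiveSum_eq_mul hN hM (-z⁻¹) 0 1]
    ext i j
    simp [Matrix.mul_apply, Polynomial.eval_finsetSum]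
  · rw [happly]
    refine Finset.sum_eq_zero fun n _ => ?_
    rw [iteratedPrimitive_apply_eq_zero hM 0 n (by have : (j : ℕ) < i := hij; omega),
      Polynomial.eval_zero, mul_zero]
  · rw [happly, Finset.sum_eq_single 0]
    · simp [iteratedPrimitive]
    · intro n _ hn
      simp [iteratedPrimitive_apply_self hM, hn]
    · simp
      omega
  · refine ⟨∑ n ∈ Finset.range N,
      Polynomial.monomial n ((-1) ^ n * (iteratedPrimitive M 0 n i j).eval 1), ?_,
      Eventually.of_forall fun z => ?_⟩
    · rw [Polynomial.finsetSum_coeff]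
      refine Finset.sum_eq_zero fun n _ => ?_
      rw [Polynomial.coeff_monomial]
      split_ifs with hn
      · simp [hn, iteratedPrimitive, Matrix.one_apply_ne hij]
      · rfl
    · simp only [happly, Polynomial.eval_finsetSum, Polynomial.eval_monomial]
      refine Finset.sum_congr rfl fun n _ => ?_
      rw [neg_pow z⁻¹]
      ring
  · choose Q hQ using fun n => pow_dvd_iteratedPrimitive (M := M) 1 n i j
    obtain ⟨p, hp⟩ := hv
    have hslope : AnalyticAt ℂ (dslope v 0) 0 := hp.has_fpower_series_dslope_fslope.analyticAt
    refine ⟨fun z => ∑ n ∈ Finset.range N, (-dslope v 0 z) ^ n * (Q n).eval (v z), ?_, ?_⟩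
    · refine Finset.analyticAt_fun_sum _ fun n _ => (hslope.neg.pow n).mul ?_
      simpa [Polynomial.coe_aeval_eq_eval] using hp.analyticAt.aeval_polynomial (Q n)
    · filter_upwards [self_mem_nhdsWithin] with z hz
      have hz : z ≠ 0 := hz
      rw [happly]
      refine Finset.sum_congr rfl fun n _ => ?_
      rw [hQ n, dslope_of_ne _ hz, slope_def_field, hv0, Polynomial.eval_mul,
        Polynomial.eval_pow, Polynomial.eval_sub, Polynomial.eval_X, Polynomial.eval_C,
        ← mul_assoc, ← mul_pow]
      congr 2
      rw [sub_zero]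
      ring
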